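/- For every integer n ≥ 0, the number of super Dyck paths of length 2n equals C(2n, n); moreover, for n ≥ 1 this equals 2·C(2n−1, n), which is twice the total number of humps HC_n over all Dyck paths of length 2n. -/

import Mathlib

open Finset

/-- The value of a Dyck-path step: `true` is an up-step (+1), `false` a down-step (-1). -/
def stepVal (b : Bool) : ℤ := if b then 1 else -1

/-- Partial sum of the first `k` steps of a ±1 path of length `m`. -/
def partialSum {m : ℕ} (p : Fin m → Bool) (k : ℕ) : ℤ :=
  ∑ i ∈ Finset.univ.filter (fun i : Fin m => (i : ℕ) < k), stepVal (p i)

/-- A Dyck path: total sum 0 and all partial sums nonnegative. -/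
def IsDyckPath {m : ℕ} (p : Fin m → Bool) : Prop :=
  partialSum p m = 0 ∧ ∀ k ≤ m, 0 ≤ partialSum p k

open Classical in
/-- The finset of Dyck paths of length `m`. -/
noncomputable def dyckPaths (m : ℕ) : Finset (Fin m → Bool) :=
  Finset.univ.filter (fun p => IsDyckPath p)

/-- Number of humps (an up-step immediately followed by a down-step) of a path. -/
def humps {m : ℕ} (p : Fin m → Bool) : ℕ :=
  (Finset.univ.filter (fun i : Fin (m - 1) =>
    p ⟨(i : ℕ), by have := i.isLt; omega⟩ = true ∧
    p ⟨(i : ℕ) + 1, by have := i.isLt; omega⟩ = false)).card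

/-- `HC n`: the total number of humps over all Dyck paths of length `2n`. -/
noncomputable def HC (n : ℕ) : ℕ := ∑ p ∈ dyckPaths (2 * n), humps p

open Classical in
/-- The finset of super Dyck paths of length `m`: total sum 0, partial sums unrestricted. -/
noncomputable def superDyckPaths (m : ℕ) : Finset (Fin m → Bool) :=
  Finset.univ.filter (fun p => partialSum p m = 0)

/-- `SD n`: the number of super Dyck paths of length `2n`. -/
noncomputable def SD (n : ℕ) : ℕ := (superDyckPaths (2 * n)).card

theorem partialSum_zero {m : ℕ} (p : Fin m → Bool) : partialSum p 0 = 0 := by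
  simp [partialSum]

theorem partialSum_succ {m : ℕ} (p : Fin m → Bool) {k : ℕ} (hk : k < m) :
    partialSum p (k + 1) = partialSum p k + stepVal (p ⟨k, hk⟩) := by
  have h : Finset.univ.filter (fun i : Fin m => (i : ℕ) < k + 1) =
      insert ⟨k, hk⟩ (Finset.univ.filter (fun i : Fin m => (i : ℕ) < k)) := by
    ext i
    simp only [Finset.mem_filter, Finset.mem_univ, true_and, Finset.mem_insert, Fin.ext_iff]
    omega
  rw [partialSum, h, Finset.sum_insert (by simp), add_comm, partialSum]

theorem partialSum_length {m : ℕ} (p : Fin m → Bool) :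
    partialSum p m = 2 * (Finset.univ.filter fun i => p i = true).card - m := by
  have h (b : Bool) : stepVal b = 2 * (if b = true then 1 else 0) - 1 := by
    cases b <;> simp [stepVal]
  have hu : Finset.univ.filter (fun i : Fin m => (i : ℕ) < m) = Finset.univ := by simp
  rw [partialSum, hu]
  simp only [h, Finset.sum_sub_distrib, ← Finset.mul_sum, Finset.sum_boole]
  simp

theorem SD_eq_choose (n : ℕ) : SD n = (2 * n).choose n := by
  have hc : ((Finset.univ : Finset (Fin (2 * n))).powersetCard n).card = (2 * n).choose n := by
    simp
  rw [← hc, SD]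
  refine Finset.card_nbij' (fun p => Finset.univ.filter fun i => p i = true)
    (fun s i => decide (i ∈ s)) ?_ ?_ ?_ ?_
  · intro p hp
    simp only [superDyckPaths, Finset.coe_filter, Finset.mem_univ, true_and, Set.mem_ofPred_eq,
      partialSum_length] at hp
    simp only [Finset.mem_coe, Finset.mem_powersetCard, Finset.subset_univ, true_and]
    push_cast at hp
    omega
  · intro s hs
    simp only [Finset.mem_coe, Finset.mem_powersetCard, Finset.subset_univ, true_and] at hs
    simp [superDyckPaths, partialSum_length, hs]
  · intro p _
    simp
  · intro s _
    simp

/-- The step of a `DyckWord` corresponding to a Boolean step. -/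
def toDyckStep (b : Bool) : DyckStep := if b then .U else .D

theorem toDyckStep_injective : Function.Injective toDyckStep := by
  intro a b
  cases a <;> cases b <;> simp [toDyckStep]

theorem toDyckStep_surjective : Function.Surjective toDyckStep := by
  rintro (_ | _)
  · exact ⟨true, rfl⟩
  · exact ⟨false, rfl⟩

theorem count_U_sub_count_D_take {m : ℕ} (p : Fin m → Bool) {k : ℕ} (hk : k ≤ m) :
    (((List.ofFn (toDyckStep ∘ p)).take k).count .U : ℤ) -
      ((List.ofFn (toDyckStep ∘ p)).take k).count .D = partialSum p k := by
  induction k with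
  | zero => simp [partialSum_zero]
  | succ k ih =>
    rw [partialSum_succ p hk, ← ih (by omega), List.take_succ_eq_append_getElem (by simpa using hk)]
    cases h : p ⟨k, hk⟩ <;> simp [h, toDyckStep, stepVal] <;> ring

theorem isDyckPath_iff {m : ℕ} (p : Fin m → Bool) :
    IsDyckPath p ↔
      (List.ofFn (toDyckStep ∘ p)).count .U = (List.ofFn (toDyckStep ∘ p)).count .D ∧
      ∀ i, ((List.ofFn (toDyckStep ∘ p)).take i).count .D ≤
        ((List.ofFn (toDyckStep ∘ p)).take i).count .U := by
  have hm := count_U_sub_count_D_take p le_rfl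
  rw [List.take_of_length_le (by simp)] at hm
  constructor
  · rintro ⟨h0, h⟩
    refine ⟨by omega, fun i => ?_⟩
    rcases le_total i m with hi | hi
    · have := count_U_sub_count_D_take p hi
      have := h i hi
      omega
    · rw [List.take_of_length_le (by simpa using hi)]
      omega
  · rintro ⟨h0, h⟩
    refine ⟨by omega, fun k hk => ?_⟩
    have := count_U_sub_count_D_take p hk
    have := h k
    omega

theorem card_dyckPaths (n : ℕ) : (dyckPaths (2 * n)).card = catalan n := by
  rw [← DyckWord.card_dyckWord_semilength_eq_catalan, ← Fintype.card_coe]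
  have mem (p : Fin (2 * n) → Bool) : p ∈ dyckPaths (2 * n) ↔ IsDyckPath p := by
    simp [dyckPaths]
  let f : dyckPaths (2 * n) → { w : DyckWord // w.semilength = n } := fun p =>
    ⟨⟨List.ofFn (toDyckStep ∘ p.1), ((isDyckPath_iff _).1 ((mem _).1 p.2)).1,
      ((isDyckPath_iff _).1 ((mem _).1 p.2)).2⟩, by
        have h := DyckWord.two_mul_semilength_eq_length
          (p := ⟨List.ofFn (toDyckStep ∘ p.1), ((isDyckPath_iff _).1 ((mem _).1 p.2)).1,
            ((isDyckPath_iff _).1 ((mem _).1 p.2)).2⟩)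
        simp only [List.length_ofFn] at h
        omega⟩
  refine Fintype.card_of_bijective (f := f) ⟨?_, ?_⟩
  · intro p q h
    have h' : List.ofFn (toDyckStep ∘ p.1) = List.ofFn (toDyckStep ∘ q.1) :=
      congrArg (fun w => w.1.toList) h
    exact Subtype.ext (toDyckStep_injective.comp_left (List.ofFn_injective h'))
  · rintro ⟨w, hw⟩
    have hl : w.toList.length = 2 * n := by
      rw [← DyckWord.two_mul_semilength_eq_length, hw]
    obtain ⟨p, hp⟩ := toDyckStep_surjective.comp_left
      (fun i : Fin (2 * n) => w.toList[(i : ℕ)]'(by omega))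
    have hp' : List.ofFn (toDyckStep ∘ p) = w.toList := by
      dsimp only at hp
      rw [hp]
      exact List.ext_getElem (by simp [hl]) (by simp)
    refine ⟨⟨p, (mem p).2 ((isDyckPath_iff p).2 ?_)⟩, Subtype.ext (DyckWord.ext hp')⟩
    rw [hp']
    exact ⟨w.count_U_eq_count_D, w.count_D_le_count_U⟩

/-- Insert a hump after the first `i` steps of a path. -/
def insertHump {m : ℕ} (i : ℕ) (hi : i ≤ m) (q : Fin m → Bool) (j : Fin (m + 2)) : Bool :=
  if h : (j : ℕ) < i then q ⟨j, by omega⟩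
  else if h₁ : (j : ℕ) = i then true
  else if h₂ : (j : ℕ) = i + 1 then false
  else q ⟨j - 2, by omega⟩

/-- Remove the steps `i` and `i + 1` of a path. -/
def removeHump {m : ℕ} (i : ℕ) (p : Fin (m + 2) → Bool) (j : Fin m) : Bool :=
  if (j : ℕ) < i then p ⟨j, by omega⟩ else p ⟨j + 2, by omega⟩

theorem removeHump_insertHump {m i : ℕ} (hi : i ≤ m) (q : Fin m → Bool) :
    removeHump i (insertHump i hi q) = q := by
  funext j
  unfold removeHump insertHump
  grind

theorem insertHump_removeHump {m i : ℕ} (hi : i ≤ m) (p : Fin (m + 2) → Bool)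
    (h₁ : p ⟨i, by omega⟩ = true) (h₂ : p ⟨i + 1, by omega⟩ = false) :
    insertHump i hi (removeHump i p) = p := by
  funext ⟨j, hj⟩
  unfold removeHump insertHump
  grind

theorem partialSum_insertHump_of_le {m i : ℕ} (hi : i ≤ m) (q : Fin m → Bool) {k : ℕ}
    (hk : k ≤ i) : partialSum (insertHump i hi q) k = partialSum q k := by
  induction k with
  | zero => simp [partialSum_zero]
  | succ k ih =>
    rw [partialSum_succ _ (by omega), partialSum_succ _ (by omega), ih (by omega)]
    simp [insertHump, show k < i by omega]

theorem partialSum_insertHump_succ {m i : ℕ} (hi : i ≤ m) (q : Fin m → Bool) :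
    partialSum (insertHump i hi q) (i + 1) = partialSum q i + 1 := by
  rw [partialSum_succ _ (by omega), partialSum_insertHump_of_le hi q le_rfl]
  simp [insertHump, stepVal]

theorem partialSum_insertHump_add_two {m i : ℕ} (hi : i ≤ m) (q : Fin m → Bool) {k : ℕ}
    (hk : i ≤ k) (hkm : k ≤ m) : partialSum (insertHump i hi q) (k + 2) = partialSum q k := by
  induction k, hk using Nat.le_induction with
  | base =>
    rw [partialSum_succ _ (by omega), partialSum_insertHump_succ]
    simp [insertHump, stepVal]
  | succ k hk ih =>
    rw [show k + 1 + 2 = k + 2 + 1 by omega, partialSum_succ _ (by omega), ih (by omega),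
      partialSum_succ _ (by omega)]
    simp [insertHump, show ¬ k + 2 < i by omega, show k + 2 ≠ i by omega,
      show k + 1 ≠ i by omega]

theorem isDyckPath_insertHump_iff {m i : ℕ} (hi : i ≤ m) (q : Fin m → Bool) :
    IsDyckPath (insertHump i hi q) ↔ IsDyckPath q := by
  unfold IsDyckPath
  rw [partialSum_insertHump_add_two hi q hi le_rfl]
  refine and_congr_right fun _ => ⟨fun h k hk => ?_, fun h k hk => ?_⟩
  · rcases le_total k i with hki | hki
    · rw [← partialSum_insertHump_of_le hi q hki]
      exact h k (by omega)
    · rw [← partialSum_insertHump_add_two hi q hki hk]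
      exact h (k + 2) (by omega)
  · rcases lt_trichotomy k (i + 1) with hki | rfl | hki
    · rw [partialSum_insertHump_of_le hi q (by omega)]
      exact h k (by omega)
    · rw [partialSum_insertHump_succ]
      have := h i hi
      omega
    · obtain ⟨l, rfl⟩ : ∃ l, k = l + 2 := ⟨k - 2, by omega⟩
      rw [partialSum_insertHump_add_two hi q (by omega) (by omega)]
      exact h l (by omega)

theorem card_dyckPaths_hump_at {m i : ℕ} (hi : i ≤ m) :
    ((dyckPaths (m + 2)).filter fun p =>
      p ⟨i, by omega⟩ = true ∧ p ⟨i + 1, by omega⟩ = false).card = (dyckPaths m).card := by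
  refine Finset.card_nbij' (removeHump i) (insertHump i hi) ?_ ?_ ?_ ?_
  · intro p hp
    simp only [dyckPaths, Finset.coe_filter, Finset.mem_filter, Finset.mem_univ, true_and,
      Set.mem_ofPred_eq] at hp ⊢
    rw [← isDyckPath_insertHump_iff hi, insertHump_removeHump hi p hp.2.1 hp.2.2]
    exact hp.1
  · intro q hq
    simp only [dyckPaths, Finset.coe_filter, Finset.mem_filter, Finset.mem_univ, true_and,
      Set.mem_ofPred_eq] at hq ⊢
    exact ⟨(isDyckPath_insertHump_iff hi q).2 hq, by simp [insertHump], by simp [insertHump]⟩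
  · intro p hp
    simp only [Finset.coe_filter, Set.mem_ofPred_eq] at hp
    exact insertHump_removeHump hi p hp.2.1 hp.2.2
  · intro q _
    exact removeHump_insertHump hi q

theorem sum_humps_dyckPaths (m : ℕ) :
    ∑ p ∈ dyckPaths (m + 2), humps p = (m + 1) * (dyckPaths m).card := by
  simp only [humps, Finset.card_filter]
  rw [Finset.sum_comm]
  simp only [← Finset.card_filter]
  trans ∑ _i : Fin (m + 1), (dyckPaths m).card
  · exact Finset.sum_congr rfl fun i _ => card_dyckPaths_hump_at (Nat.lt_succ_iff.1 i.isLt)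
  · simp

theorem HC_succ (n : ℕ) : HC (n + 1) = (2 * n + 1) * catalan n := by
  rw [← card_dyckPaths, ← sum_humps_dyckPaths]
  rfl

/-- The number of super Dyck paths of length `2n` equals `C(2n, n)`; moreover, for
`n ≥ 1` this equals `2 · C(2n-1, n)`, which is twice the total number of humps `HC n`. -/
theorem super_dyck_count (n : ℕ) :
    SD n = (2 * n).choose n ∧
      (1 ≤ n → SD n = 2 * (2 * n - 1).choose n ∧ SD n = 2 * HC n) := by
  refine ⟨SD_eq_choose n, fun hn => ?_⟩
  obtain ⟨k, rfl⟩ : ∃ k, n = k + 1 := ⟨n - 1, by omega⟩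
  rw [SD_eq_choose]
  constructor
  · rw [show 2 * (k + 1) - 1 = 2 * k + 1 by omega, show 2 * (k + 1) = 2 * k + 1 + 1 by ring,
      Nat.choose_succ_succ, Nat.choose_symm_half]
    ring
  · have h₁ := Nat.succ_mul_centralBinom_succ k
    have h₂ := succ_mul_catalan_eq_centralBinom k
    rw [← Nat.centralBinom_eq_two_mul_choose, HC_succ]
    apply Nat.eq_of_mul_eq_mul_left k.succ_pos
    rw [Nat.succ_eq_add_one, h₁, ← h₂]
    ring
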